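/- Let p be a prime, m a positive integer, q = p^m, and ζ_q = exp(2πi/q). Then the complex numbers 1 - ζ_q together with the numbers (1 - ζ_q^{a})/(1 - ζ_q) for all integers a with 1 < a < q/2 and gcd(a, q) = 1 are multiplicatively independent: if (1 - ζ_q)^{α} · ∏_a ((1 - ζ_q^{a})/(1 - ζ_q))^{β_a} = 1 for integers α and β_a, then α = 0 and all β_a = 0. -/

import Mathlib

open Complex

open Filter Topology Finset in
/-- Summation by parts for a series whose coefficients have bounded partial sums. -/
theorem tendsto_sum_mul_of_bounded_partial_sums {g b : ℕ → ℝ} {f : ℕ → ℂ} {C : ℝ}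
    (hf : ∀ n, ‖∑ i ∈ range n, f i‖ ≤ C) (hg : Tendsto g atTop (𝓝 0)) (hb : Summable b)
    (hgb : ∀ i, |g i - g (i + 1)| ≤ b i) :
    Tendsto (fun n => ∑ i ∈ range n, (g i : ℂ) * f i) atTop
      (𝓝 (∑' i, ((g i - g (i + 1) : ℝ) : ℂ) * ∑ j ∈ range (i + 1), f j)) := by
  have by_parts (n : ℕ) : ∑ i ∈ range n, (g i : ℂ) * f i = (g n : ℂ) * ∑ i ∈ range n, f i +
      ∑ i ∈ range n, ((g i - g (i + 1) : ℝ) : ℂ) * ∑ j ∈ range (i + 1), f j := by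
    induction n with
    | zero => simp
    | succ n ih =>
      rw [sum_range_succ, ih, sum_range_succ (fun i => ((g i - g (i + 1) : ℝ) : ℂ) * _) n,
        sum_range_succ f n]
      push_cast
      ring
  have boundary : Tendsto (fun n => (g n : ℂ) * ∑ i ∈ range n, f i) atTop (𝓝 0) := by
    rw [tendsto_zero_iff_norm_tendsto_zero]
    refine squeeze_zero (fun _ => norm_nonneg _)
      (g := fun n => |g n| * C) (fun n => ?_) (by simpa using hg.abs.mul_const C)
    rw [norm_mul, norm_real, Real.norm_eq_abs]
    gcongr
    exact hf n
  have summable : Summable fun i =>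
      ((g i - g (i + 1) : ℝ) : ℂ) * ∑ j ∈ range (i + 1), f j := by
    refine (hb.mul_right C).of_norm_bounded fun i => ?_
    rw [norm_mul, norm_real, Real.norm_eq_abs]
    exact mul_le_mul (hgb i) (hf _) (norm_nonneg _) ((abs_nonneg _).trans (hgb i))
  simp_rw [by_parts]
  simpa using boundary.add summable.hasSum.tendsto_sum_nat

theorem abs_rpow_neg_sub_rpow_neg_le {s : ℝ} (h₁ : 1 ≤ s) (h₂ : s ≤ 2) (i : ℕ) :
    |((i : ℝ) + 1) ^ (-s) - ((i + 1 : ℕ) + 1 : ℝ) ^ (-s)| ≤ 2 / ((i + 1 : ℕ) : ℝ) ^ 2 := by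
  push_cast
  set x : ℝ := (i : ℝ) + 1 with hx
  have hx1 : 1 ≤ x := by simp [hx]
  have hx0 : 0 < x := by linarith
  have bern := one_add_mul_self_le_rpow_one_add (s := -(1 / (x + 1)))
    (by rw [neg_le_neg_iff, div_le_one (by linarith)]; linarith) h₁
  have ratio : (1 + -(1 / (x + 1))) = x / (x + 1) := by field_simp; ring
  have factor : (x + 1) ^ (-s) = x ^ (-s) * (x / (x + 1)) ^ s := by
    rw [Real.div_rpow hx0.le (by linarith), Real.rpow_neg hx0.le, Real.rpow_neg (by linarith)]
    have := (Real.rpow_pos_of_pos hx0 s).ne'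
    field_simp
  have mono : (x + 1) ^ (-s) ≤ x ^ (-s) :=
    Real.rpow_le_rpow_of_nonpos hx0 (by linarith) (by linarith)
  have le_inv : x ^ (-s) ≤ x⁻¹ := by
    rw [← Real.rpow_neg_one]
    exact Real.rpow_le_rpow_of_exponent_le hx1 (by linarith)
  rw [abs_of_nonneg (by linarith), factor]
  rw [ratio] at bern
  have pos := Real.rpow_pos_of_pos hx0 (-s)
  calc x ^ (-s) - x ^ (-s) * (x / (x + 1)) ^ s = x ^ (-s) * (1 - (x / (x + 1)) ^ s) := by ring
    _ ≤ x ^ (-s) * (s * (1 / (x + 1))) := by gcongr; linarith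
    _ ≤ x⁻¹ * (2 * (1 / x)) := by gcongr; linarith
    _ = 2 / x ^ 2 := by field_simp

theorem Complex.re_lt_one_of_norm_eq_one {z : ℂ} (hz : ‖z‖ = 1) (hz1 : z ≠ 1) : z.re < 1 := by
  refine lt_of_le_of_ne (hz ▸ re_le_norm z) fun h => hz1 ?_
  have := Complex.sq_norm z
  rw [hz, normSq_apply, h] at this
  exact Complex.ext h (by simpa using (show z.im * z.im = 0 by linarith))

open Filter Topology Finset HurwitzZeta in
/-- The value at `1` of the periodic zeta function. -/
theorem HurwitzZeta.expZeta_one {x : ℝ} (hx : (x : UnitAddCircle) ≠ 0) :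
    expZeta x 1 = -log (1 - exp (2 * Real.pi * I * x)) := by
  set z : ℂ := exp (2 * Real.pi * I * x) with hz
  have norm_z : ‖z‖ = 1 := by
    rw [hz, show (2 * Real.pi * I * x : ℂ) = ((2 * Real.pi * x : ℝ) : ℂ) * I by push_cast; ring]
    exact norm_exp_ofReal_mul_I _
  have z_ne : z ≠ 1 := by
    intro h
    obtain ⟨n, hn⟩ := Complex.exp_eq_one_iff.mp h
    refine hx ((AddCircle.coe_eq_zero_iff 1).mpr ⟨n, ?_⟩)
    have h2 : (2 * Real.pi * I : ℂ) ≠ 0 := Complex.two_pi_I_ne_zero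
    have : (x : ℂ) = n := mul_left_cancel₀ h2 (by rw [hn]; ring)
    have : x = n := by exact_mod_cast this
    simp [this]
  have partial_le (n : ℕ) : ‖∑ i ∈ range n, z ^ (i + 1)‖ ≤ 2 / ‖z - 1‖ := by
    simp_rw [pow_succ']
    rw [← mul_sum, geom_sum_eq z_ne, norm_mul, norm_z, one_mul, norm_div]
    gcongr
    refine (norm_sub_le _ _).trans ?_
    rw [norm_pow, norm_z]
    norm_num
  have b_summable : Summable fun i : ℕ => 2 / ((i + 1 : ℕ) : ℝ) ^ 2 := by
    refine (summable_nat_add_iff (f := fun i : ℕ => 2 / (i : ℝ) ^ 2) 1).mpr ?_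
    simpa [div_eq_mul_inv] using (Real.summable_nat_pow_inv.mpr one_lt_two).mul_left 2
  set T : ℝ → ℂ := fun s => ∑' i : ℕ,
    ((((i : ℝ) + 1) ^ (-s) - ((i + 1 : ℕ) + 1 : ℝ) ^ (-s) : ℝ) : ℂ) *
      ∑ j ∈ range (i + 1), z ^ (j + 1) with hT
  have sums {s : ℝ} (h₁ : 1 ≤ s) (h₂ : s ≤ 2) :
      Tendsto (fun n => ∑ i ∈ range n, ((((i : ℝ) + 1) ^ (-s) : ℝ) : ℂ) * z ^ (i + 1))
        atTop (𝓝 (T s)) := by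
    refine tendsto_sum_mul_of_bounded_partial_sums (g := fun i : ℕ => ((i : ℝ) + 1) ^ (-s))
      partial_le ?_ b_summable (abs_rpow_neg_sub_rpow_neg_le h₁ h₂)
    exact (tendsto_rpow_neg_atTop (by linarith)).comp
      (tendsto_atTop_add_const_right _ _ tendsto_natCast_atTop_atTop)
  have T_eq {s : ℝ} (h₁ : 1 < s) (h₂ : s ≤ 2) : T s = expZeta x s := by
    have h := hasSum_expZeta_of_one_lt_re x (s := s) (by simpa using h₁)
    rw [← hasSum_nat_add_iff' 1] at h
    have h0 : (s : ℂ) ≠ 0 := by exact_mod_cast (by linarith : s ≠ 0)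
    refine tendsto_nhds_unique (sums h₁.le h₂) ?_
    convert h.tendsto_sum_nat using 2 with n
    · refine sum_congr rfl fun i _ => ?_
      rw [Real.rpow_neg (by positivity), ofReal_inv, ofReal_cpow (by positivity), hz,
        ← Complex.exp_nat_mul]
      push_cast
      rw [div_eq_inv_mul]
      congr 2
      ring
    · simp [h0]
  have T_lim : Tendsto T (𝓝[>] 1) (𝓝 (T 1)) := by
    refine tendsto_tsum_of_dominated_convergence
      (bound := fun i : ℕ => 2 / ((i + 1 : ℕ) : ℝ) ^ 2 * (2 / ‖z - 1‖))
      (b_summable.mul_right _) (fun i => ?_) ?_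
    · refine tendsto_nhdsWithin_of_tendsto_nhds (ContinuousAt.tendsto (x := (1 : ℝ)) ?_)
      have h1 : ((i : ℝ) + 1) ≠ 0 := by positivity
      have h2 : (((i + 1 : ℕ) : ℝ) + 1) ≠ 0 := by positivity
      refine ContinuousAt.mul (continuous_ofReal.continuousAt.comp (.sub ?_ ?_))
        continuousAt_const
      · exact (Real.continuousAt_const_rpow h1).comp continuousAt_neg
      · exact (Real.continuousAt_const_rpow h2).comp continuousAt_neg
    · filter_upwards [Ioc_mem_nhdsGT (one_lt_two (α := ℝ))] with s hs i
      rw [norm_mul, norm_real, Real.norm_eq_abs]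
      gcongr
      · exact abs_rpow_neg_sub_rpow_neg_le hs.1.le hs.2 i
      · exact partial_le _
  have expZeta_eq : expZeta x 1 = T 1 := by
    have cont := (differentiable_expZeta_of_ne_zero hx).continuous.comp continuous_ofReal
    have lim : Tendsto (fun s : ℝ => expZeta x s) (𝓝[>] 1) (𝓝 (expZeta x 1)) := by
      simpa [Function.comp_def] using (cont.tendsto 1).mono_left nhdsWithin_le_nhds
    refine tendsto_nhds_unique (lim.congr' ?_) T_lim
    filter_upwards [Ioc_mem_nhdsGT (one_lt_two (α := ℝ))] with s hs
    exact (T_eq hs.1 hs.2).symm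
  have abel : Tendsto (fun n => ∑ i ∈ range n, z ^ i / (i : ℂ)) atTop (𝓝 (T 1)) := by
    rw [← tendsto_add_atTop_iff_nat 1]
    convert sums le_rfl one_le_two using 2 with n
    rw [sum_range_succ']
    simp [div_eq_inv_mul, Real.rpow_neg_one]
  have lim := tendsto_tsum_powerSeries_nhdsWithin_lt abel
  rw [tendsto_map'_iff] at lim
  have slit : 1 - z ∈ slitPlane := Or.inl (by simpa using re_lt_one_of_norm_eq_one norm_z z_ne)
  have lim' : Tendsto (fun r : ℝ => -log (1 - z * r)) (𝓝[<] 1) (𝓝 (-log (1 - z))) := by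
    have : ContinuousAt (fun r : ℝ => -log (1 - z * r)) 1 := by
      refine (ContinuousAt.clog (by fun_prop) ?_).neg
      simpa using slit
    simpa using this.tendsto.mono_left nhdsWithin_le_nhds
  rw [expZeta_eq]
  refine tendsto_nhds_unique lim (lim'.congr' ?_)
  filter_upwards [Ioo_mem_nhdsLT (zero_lt_one (α := ℝ))] with r hr
  have : ‖z * r‖ < 1 := by
    rw [norm_mul, norm_z, norm_real, one_mul, Real.norm_of_nonneg hr.1.le]
    exact hr.2
  rw [← (hasSum_taylorSeries_neg_log this).tsum_eq]
  refine tsum_congr fun n => ?_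
  rw [mul_pow]
  ring

open HurwitzZeta in
theorem HurwitzZeta.expZeta_toAddCircle_one {N : ℕ} [NeZero N] {j : ZMod N} (hj : j ≠ 0) :
    expZeta (ZMod.toAddCircle j) 1 = -log (1 - ZMod.stdAddChar j) := by
  have h : ZMod.toAddCircle j ≠ 0 := ZMod.toAddCircle_eq_zero.not.mpr hj
  rw [ZMod.toAddCircle_apply] at h ⊢
  rw [expZeta_one h, ZMod.stdAddChar_apply, ZMod.toCircle_apply]
  push_cast
  ring_nf

theorem ZMod.norm_stdAddChar {N : ℕ} [NeZero N] (j : ZMod N) : ‖ZMod.stdAddChar j‖ = 1 := by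
  rw [ZMod.stdAddChar_apply]
  exact Circle.norm_coe _

theorem ZMod.stdAddChar_ne_one {N : ℕ} [NeZero N] {j : ZMod N} (hj : j ≠ 0) :
    ZMod.stdAddChar j ≠ 1 :=
  fun h => hj (ZMod.injective_stdAddChar (h.trans (AddChar.map_zero_eq_one _).symm))

open HurwitzZeta in
theorem HurwitzZeta.cosZeta_toAddCircle_one {N : ℕ} [NeZero N] {j : ZMod N} (hj : j ≠ 0) :
    cosZeta (ZMod.toAddCircle j) 1 = -(Real.log ‖1 - ZMod.stdAddChar j‖ : ℂ) := by
  have conj_eq : ZMod.stdAddChar (-j) = (starRingEnd ℂ) (ZMod.stdAddChar j) := by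
    rw [AddChar.map_neg_eq_inv, Complex.inv_def, normSq_eq_norm_sq, ZMod.norm_stdAddChar]
    simp
  have arg_ne : (1 - ZMod.stdAddChar j).arg ≠ Real.pi := by
    refine (mem_slitPlane_iff_arg.mp (Or.inl ?_)).1
    simpa using re_lt_one_of_norm_eq_one (ZMod.norm_stdAddChar j) (ZMod.stdAddChar_ne_one hj)
  rw [cosZeta_eq, ← map_neg, expZeta_toAddCircle_one hj,
    expZeta_toAddCircle_one (neg_ne_zero.mpr hj), conj_eq,
    show 1 - (starRingEnd ℂ) (ZMod.stdAddChar j) = (starRingEnd ℂ) (1 - ZMod.stdAddChar j) by simp,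
    log_conj _ arg_ne, ← neg_add, add_conj, log_re]
  push_cast
  ring

namespace ZMod

open scoped ZMod

theorem LFunction_dft_one_of_even {N : ℕ} [NeZero N] {Φ : ZMod N → ℂ} (hΦ : Φ.Even)
    (h0 : Φ 0 = 0) :
    LFunction (𝓕 Φ) 1 = -∑ j, Φ j * (Real.log ‖1 - stdAddChar j‖ : ℂ) := by
  have cos_sum : LFunction (𝓕 Φ) 1 = ∑ j, Φ j * HurwitzZeta.cosZeta (toAddCircle j) 1 := by
    have h := LFunction_dft Φ (Or.inl h0 : Φ 0 = 0 ∨ (1 : ℂ) ≠ 1)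
    have h' : LFunction (𝓕 Φ) 1 = ∑ j, Φ j * HurwitzZeta.expZeta (toAddCircle j) 1 := by
      rw [h]
      refine Fintype.sum_equiv (.neg _) _ _ fun j => ?_
      rw [Equiv.neg_apply, hΦ j]
    simp_rw [HurwitzZeta.cosZeta_eq, ← mul_div_assoc, mul_add, ← map_neg]
    rw [← Finset.sum_div, Finset.sum_add_distrib, ← h, ← h']
    ring
  rw [cos_sum, ← Finset.sum_neg_distrib]
  refine Finset.sum_congr rfl fun j _ => ?_
  rcases eq_or_ne j 0 with rfl | hj
  · simp [h0]
  · rw [HurwitzZeta.cosZeta_toAddCircle_one hj, mul_neg]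

theorem LFunction_one_sub_of_even {N : ℕ} [NeZero N] {Φ : ZMod N → ℂ} (hΦ : Φ.Even)
    (h0 : Φ 0 = 0) {s : ℂ} (hs : ∀ n : ℕ, s ≠ -n) :
    LFunction Φ (1 - s) = (2 * Real.pi) ^ (-s) * Gamma s * (2 * cos (Real.pi * s / 2)) *
      (N ^ (s - 1) * LFunction (𝓕 Φ) s) := by
  rw [LFunction_one_sub Φ hs (Or.inl h0), show (fun x => Φ (-x)) = Φ from funext hΦ, two_cos,
    show (Real.pi * I * s / 2 : ℂ) = Real.pi * s / 2 * I by ring,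
    show (-Real.pi * I * s / 2 : ℂ) = -(Real.pi * s / 2) * I by ring]
  ring

theorem differentiable_LFunction_dft {N : ℕ} [NeZero N] {Φ : ZMod N → ℂ} (h0 : Φ 0 = 0) :
    Differentiable ℂ (LFunction (𝓕 Φ)) := by
  refine differentiable_LFunction_of_sum_zero ?_
  rw [← dft_apply_zero, dft_dft]
  simp [h0]

open Filter Topology in
/-- By the functional equation, the values at `1` of the `L`-functions of the Fourier transforms of
two even functions agree as soon as the `L`-functions of these functions agree. -/
theorem LFunction_dft_one_eq_of_LFunction_eq {M N : ℕ} [NeZero M] [NeZero N] {Φ : ZMod N → ℂ}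
    {Ψ : ZMod M → ℂ} (hΦ : Φ.Even) (hΨ : Ψ.Even) (hΦ0 : Φ 0 = 0) (hΨ0 : Ψ 0 = 0)
    (h : LFunction Φ = LFunction Ψ) : LFunction (𝓕 Φ) 1 = LFunction (𝓕 Ψ) 1 := by
  have lim {K : ℕ} [NeZero K] {Θ : ZMod K → ℂ} (hΘ : Θ 0 = 0) :
      Tendsto (fun s : ℝ => (K : ℂ) ^ ((s : ℂ) - 1) * LFunction (𝓕 Θ) s) (𝓝[>] 1)
        (𝓝 (LFunction (𝓕 Θ) 1)) := by
    have cont : Continuous fun s : ℝ => (K : ℂ) ^ ((s : ℂ) - 1) * LFunction (𝓕 Θ) s := by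
      refine .mul (.const_cpow (by fun_prop) (Or.inl (by exact_mod_cast NeZero.ne K))) ?_
      exact (differentiable_LFunction_dft hΘ).continuous.comp continuous_ofReal
    simpa using (cont.tendsto 1).mono_left nhdsWithin_le_nhds
  refine tendsto_nhds_unique (lim hΦ0) ((lim hΨ0).congr' ?_)
  filter_upwards [Ioo_mem_nhdsGT (one_lt_two (α := ℝ))] with s hs
  have hs' (n : ℕ) : (s : ℂ) ≠ -n := by
    have : s ≠ -n := by have := n.cast_nonneg (α := ℝ); have := hs.1; intro; linarith
    exact_mod_cast this
  have cos_ne : cos (Real.pi * s / 2) ≠ 0 := by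
    have : Real.cos (Real.pi * s / 2) < 0 :=
      Real.cos_neg_of_pi_div_two_lt_of_lt (by nlinarith [Real.pi_pos, hs.1])
        (by nlinarith [Real.pi_pos, hs.2])
    exact_mod_cast this.ne
  have factor_ne : ((2 * Real.pi : ℂ)) ^ (-s : ℂ) * Gamma s * (2 * cos (Real.pi * s / 2)) ≠ 0 := by
    refine mul_ne_zero (mul_ne_zero ?_ (Gamma_ne_zero hs')) (mul_ne_zero two_ne_zero cos_ne)
    rw [cpow_ne_zero_iff]
    exact Or.inl (by simp [Real.pi_ne_zero])
  refine mul_left_cancel₀ factor_ne ?_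
  rw [← LFunction_one_sub_of_even hΦ hΦ0 hs', ← LFunction_one_sub_of_even hΨ hΨ0 hs', h]

end ZMod

namespace DirichletCharacter

open scoped ZMod

theorem IsPrimitive.LFunction_dft_one_ne_zero {N : ℕ} [NeZero N] {χ : DirichletCharacter ℂ N}
    (hχ : χ.IsPrimitive) (even : χ.Even) (ne_one : χ ≠ 1) : ZMod.LFunction (𝓕 χ) 1 ≠ 0 := by
  have even_inv : χ⁻¹.Even := by
    rw [DirichletCharacter.Even, MulChar.inv_apply_eq_inv, even, Ring.inverse_one]
  have dft_eq : 𝓕 χ = fun k => gaussSum χ ZMod.stdAddChar * χ⁻¹ k := by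
    ext k
    rw [hχ.fourierTransform_eq_inv_mul_gaussSum, even_inv.eval_neg, mul_comm]
  have gauss_ne : gaussSum χ ZMod.stdAddChar ≠ 0 := by
    intro h
    have : (χ : ZMod N → ℂ) = 0 := by
      rw [← (ZMod.dft (N := N) (E := ℂ)).map_eq_zero_iff, dft_eq, h]
      ext
      simp
    simpa using congrFun this 1
  have L_eq : ZMod.LFunction (𝓕 χ) 1 = gaussSum χ ZMod.stdAddChar * LFunction χ⁻¹ 1 := by
    rw [dft_eq, LFunction, ZMod.LFunction, ZMod.LFunction, mul_left_comm,
      Finset.mul_sum _ _ (gaussSum _ _)]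
    simp_rw [mul_assoc]
  rw [L_eq]
  exact mul_ne_zero gauss_ne (LFunction_apply_one_ne_zero (inv_ne_one.mpr ne_one))

theorem LFunction_dft_one_ne_zero_of_prime_pow {p m : ℕ} (hp : p.Prime) [NeZero (p ^ m)]
    {χ : DirichletCharacter ℂ (p ^ m)} (even : χ.Even) (ne_one : χ ≠ 1) :
    ZMod.LFunction (𝓕 χ) 1 ≠ 0 := by
  have cond_ne_one : χ.conductor ≠ 1 := fun h => ne_one (eq_one_iff_conductor_eq_one.mpr h)
  have : NeZero χ.conductor := ⟨conductor_ne_zero χ⟩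
  have hm : m ≠ 0 := by
    rintro rfl
    exact ne_one (level_one' χ (pow_zero p))
  have p_dvd : p ∣ χ.conductor := by
    obtain ⟨k, -, hk⟩ := (Nat.dvd_prime_pow hp).mp χ.conductor_dvd_level
    rw [hk] at cond_ne_one ⊢
    exact dvd_pow_self p (by rintro rfl; simp at cond_ne_one)
  have prim_ne_one : χ.primitiveCharacter ≠ 1 := fun h => ne_one <| by
    rw [← changeLevel_primitiveCharacter χ, h, map_one]
  have prim_even : χ.primitiveCharacter.Even := by
    have := primitiveCharacter_apply_of_isCoprime χ (a := -1) isCoprime_one_left.neg_left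
    push_cast at this
    rw [DirichletCharacter.Even, this]
    exact even
  have L_eq : ZMod.LFunction χ = ZMod.LFunction χ.primitiveCharacter := by
    ext s
    have h := LFunction_changeLevel χ.conductor_dvd_level χ.primitiveCharacter (s := s)
      (Or.inl prim_ne_one)
    have val_p : χ.primitiveCharacter p = 0 := by
      refine χ.primitiveCharacter.map_nonunit ?_
      rw [ZMod.isUnit_iff_coprime]
      exact fun hc => hp.one_lt.ne' (Nat.dvd_one.mp (hc ▸ Nat.dvd_gcd dvd_rfl p_dvd))
    rw [changeLevel_primitiveCharacter, Nat.primeFactors_prime_pow hm hp] at h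
    simpa [val_p, LFunction] using h
  rw [ZMod.LFunction_dft_one_eq_of_LFunction_eq even.to_fun prim_even.to_fun
    (map_zero' χ fun h => ne_one (level_one' χ h)) (map_zero' _ cond_ne_one) L_eq]
  exact (primitiveCharacter_isPrimitive χ).LFunction_dft_one_ne_zero prim_even prim_ne_one

end DirichletCharacter

theorem ZMod.stdAddChar_natCast_mul {N : ℕ} [NeZero N] (a : ℕ) (c : ZMod N) :
    ZMod.stdAddChar ((a : ZMod N) * c) = ZMod.stdAddChar c ^ a := by
  rw [← nsmul_eq_mul, AddChar.map_nsmul_eq_pow]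

theorem ZMod.stdAddChar_one {N : ℕ} [NeZero N] :
    ZMod.stdAddChar (1 : ZMod N) = exp (2 * Real.pi * I / N) := by
  simpa using ZMod.stdAddChar_coe (N := N) 1

theorem ZMod.isPrimitiveRoot_stdAddChar {N : ℕ} [NeZero N] {c : ZMod N} (hc : IsUnit c) :
    IsPrimitiveRoot (ZMod.stdAddChar c) N := by
  have h : ZMod.stdAddChar c = exp (2 * Real.pi * I / N) ^ c.val := by
    rw [← ZMod.stdAddChar_one, ← ZMod.stdAddChar_natCast_mul, ZMod.natCast_zmod_val, mul_one]
  rw [h]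
  refine (Complex.isPrimitiveRoot_exp N (NeZero.ne N)).pow_of_coprime _ ?_
  rwa [← ZMod.isUnit_iff_coprime, ZMod.natCast_zmod_val]

theorem sum_primitiveRoots_log_norm_one_sub {p m : ℕ} (hp : p.Prime) (hm : 0 < m) :
    ∑ μ ∈ primitiveRoots (p ^ m) ℂ, Real.log ‖1 - μ‖ = Real.log p := by
  have : Fact p.Prime := ⟨hp⟩
  obtain ⟨k, rfl⟩ := Nat.exists_eq_succ_of_ne_zero hm.ne'
  have h := Polynomial.eval_one_cyclotomic_prime_pow (R := ℂ) (p := p) k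
  rw [Polynomial.cyclotomic_eq_prod_X_sub_primitiveRoots
    (Complex.isPrimitiveRoot_exp _ (pow_pos hp.pos _).ne'), Polynomial.eval_prod] at h
  simp only [Polynomial.eval_sub, Polynomial.eval_X, Polynomial.eval_C] at h
  rw [← Real.log_prod, ← norm_prod, h, norm_natCast]
  intro μ hμ hz
  rw [norm_eq_zero] at hz
  rw [Finset.prod_eq_zero hμ hz] at h
  exact hp.ne_zero (by exact_mod_cast h.symm)

theorem sum_isUnit_log_norm_one_sub_stdAddChar (N : ℕ) [NeZero N] :
    ∑ j : ZMod N with IsUnit j, Real.log ‖1 - ZMod.stdAddChar j‖ =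
      ∑ μ ∈ primitiveRoots N ℂ, Real.log ‖1 - μ‖ := by
  refine Finset.sum_bij (fun j _ => ZMod.stdAddChar j) (fun j hj => ?_)
    (fun _ _ _ _ h => ZMod.injective_stdAddChar h) (fun μ hμ => ?_) fun _ _ => rfl
  · rw [mem_primitiveRoots (NeZero.pos N)]
    exact ZMod.isPrimitiveRoot_stdAddChar (Finset.mem_filter.mp hj).2
  · rw [mem_primitiveRoots (NeZero.pos N)] at hμ
    obtain ⟨i, -, hi, rfl⟩ :=
      ((Complex.isPrimitiveRoot_exp N (NeZero.ne N)).isPrimitiveRoot_iff).mp hμ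
    refine ⟨i, by simpa [ZMod.isUnit_iff_coprime] using hi, ?_⟩
    rw [← ZMod.stdAddChar_one, ← ZMod.stdAddChar_natCast_mul, mul_one]

theorem DirichletCharacter.sum_mul_log_norm_one_sub_ne_zero {p m : ℕ} (hp : p.Prime) (hm : 0 < m)
    [NeZero (p ^ m)] {χ : DirichletCharacter ℂ (p ^ m)} (even : χ.Even) :
    ∑ j, χ j * (Real.log ‖1 - ZMod.stdAddChar j‖ : ℂ) ≠ 0 := by
  rcases eq_or_ne χ 1 with rfl | ne_one
  · have h := sum_isUnit_log_norm_one_sub_stdAddChar (p ^ m)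
    rw [sum_primitiveRoots_log_norm_one_sub hp hm, Finset.sum_filter] at h
    have h' : ∑ j, (1 : DirichletCharacter ℂ (p ^ m)) j *
        (Real.log ‖1 - ZMod.stdAddChar j‖ : ℂ) = (Real.log p : ℂ) := by
      rw [← h, ofReal_sum]
      refine Finset.sum_congr rfl fun j _ => ?_
      by_cases hj : IsUnit j
      · rw [MulChar.one_apply hj, one_mul, if_pos hj]
      · rw [MulChar.map_nonunit _ hj, zero_mul, if_neg hj, ofReal_zero]
    rw [h']
    exact_mod_cast (Real.log_pos (by exact_mod_cast hp.one_lt)).ne'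
  · have h := LFunction_dft_one_ne_zero_of_prime_pow hp even ne_one
    rw [ZMod.LFunction_dft_one_of_even even.to_fun
      (map_zero' χ fun h => ne_one (level_one' χ h))] at h
    exact neg_ne_zero.mp h

theorem IsPrimitiveRoot.eval₂_cyclotomic_rat {n : ℕ} [NeZero n] {ξ : ℂ}
    (hξ : IsPrimitiveRoot ξ n) :
    (Polynomial.cyclotomic n ℚ).eval₂ (algebraMap ℚ ℂ) ξ = 0 := by
  rw [Polynomial.eval₂_eq_eval_map, Polynomial.map_cyclotomic]
  exact Polynomial.isRoot_cyclotomic_iff.mpr hξ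

/-- Multiplicative relations between cyclotomic numbers are preserved by Galois conjugation. -/
theorem IsPrimitiveRoot.cyclotomic_relation_conj {n : ℕ} [NeZero n] {ζ ξ : ℂ}
    (hζ : IsPrimitiveRoot ζ n) (hξ : IsPrimitiveRoot ξ n) {α : ℤ} {S : Finset ℕ} {β : ℕ → ℤ}
    (h : (1 - ζ) ^ α * ∏ a ∈ S, ((1 - ζ ^ a) / (1 - ζ)) ^ β a = 1) :
    (1 - ξ) ^ α * ∏ a ∈ S, ((1 - ξ ^ a) / (1 - ξ)) ^ β a = 1 := by
  have : Fact (Irreducible (Polynomial.cyclotomic n ℚ)) :=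
    ⟨Polynomial.cyclotomic.irreducible_rat (NeZero.pos n)⟩
  let φ := AdjoinRoot.lift (algebraMap ℚ ℂ) ζ hζ.eval₂_cyclotomic_rat
  let ψ := AdjoinRoot.lift (algebraMap ℚ ℂ) ξ hξ.eval₂_cyclotomic_rat
  let μ := AdjoinRoot.root (Polynomial.cyclotomic n ℚ)
  have hφ : φ μ = ζ := AdjoinRoot.lift_root _
  have hψ : ψ μ = ξ := AdjoinRoot.lift_root _
  have hμ : (1 - μ) ^ α * ∏ a ∈ S, ((1 - μ ^ a) / (1 - μ)) ^ β a = 1 := by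
    refine φ.injective ?_
    simpa [hφ] using h
  simpa [hψ] using congrArg ψ hμ

/-- The even Dirichlet characters separate the integers in `(1, N / 2)` prime to `N`. -/
theorem DirichletCharacter.coeff_eq_zero_of_even_sum_eq_zero {N : ℕ} [NeZero N] {S : Finset ℕ}
    (hS : ∀ a ∈ S, 1 < a ∧ 2 * a < N ∧ a.Coprime N) {β : ℕ → ℤ}
    (h : ∀ χ : DirichletCharacter ℂ N, χ.Even → ∑ a ∈ S, (β a : ℂ) * (χ a - 1) = 0) {b : ℕ}
    (hb : b ∈ S) : β b = 0 := by
  have all (χ : DirichletCharacter ℂ N) :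
      ∑ a ∈ S, (β a : ℂ) * (χ a + χ (-a) - χ 1 - χ (-1)) = 0 := by
    rcases χ.even_or_odd with hχ | hχ
    · rw [← mul_zero 2, ← h χ hχ, Finset.mul_sum]
      refine Finset.sum_congr rfl fun a _ => ?_
      rw [hχ.eval_neg, hχ.eval_neg, map_one]
      ring
    · refine Finset.sum_eq_zero fun a _ => ?_
      rw [hχ.eval_neg, hχ.eval_neg]
      ring
  have unit_b : IsUnit (b : ZMod N) := (ZMod.isUnit_iff_coprime b N).mpr (hS b hb).2.2
  have orth (c : ZMod N) := sum_char_inv_mul_char_eq ℂ unit_b c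
  have total : ∑ χ : DirichletCharacter ℂ N, χ (b : ZMod N)⁻¹ *
      ∑ a ∈ S, (β a : ℂ) * (χ a + χ (-a) - χ 1 - χ (-1)) = 0 :=
    Finset.sum_eq_zero fun χ _ => by rw [all χ, mul_zero]
  have swap : ∑ a ∈ S, (β a : ℂ) * ((if (b : ZMod N) = a then (N.totient : ℂ) else 0) +
      (if (b : ZMod N) = -a then (N.totient : ℂ) else 0) -
      (if (b : ZMod N) = 1 then (N.totient : ℂ) else 0) -
      (if (b : ZMod N) = -1 then (N.totient : ℂ) else 0)) = 0 := by
    refine Eq.trans ?_ total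
    simp_rw [Finset.mul_sum]
    rw [Finset.sum_comm]
    refine Finset.sum_congr rfl fun a _ => ?_
    rw [← orth, ← orth, ← orth, ← orth, ← Finset.sum_add_distrib, ← Finset.sum_sub_distrib,
      ← Finset.sum_sub_distrib, Finset.mul_sum]
    refine Finset.sum_congr rfl fun χ _ => ?_
    ring
  have cast_inj {x y : ℕ} (hx : x < N) (hy : y < N) (hxy : (x : ZMod N) = y) : x = y := by
    rwa [ZMod.natCast_eq_natCast_iff', Nat.mod_eq_of_lt hx, Nat.mod_eq_of_lt hy] at hxy
  have ne_neg {x y : ℕ} (hpos : 0 < x + y) (hlt : x + y < N) : (x : ZMod N) ≠ -y := by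
    intro hxy
    rw [eq_neg_iff_add_eq_zero] at hxy
    have := cast_inj hlt (NeZero.pos N) (by exact_mod_cast hxy)
    omega
  have hb' := hS b hb
  have b_ne_one : (b : ZMod N) ≠ 1 := fun hb1 => by
    have := cast_inj (x := b) (y := 1) (by omega) (by omega) (by exact_mod_cast hb1)
    omega
  have b_ne_neg_one : (b : ZMod N) ≠ -1 := by
    simpa using ne_neg (x := b) (y := 1) (by omega) (by omega)
  rw [Finset.sum_eq_single b] at swap
  · have : (b : ZMod N) ≠ -b := ne_neg (by omega) (by omega)
    simpa [b_ne_one, b_ne_neg_one, this, (Nat.totient_pos.mpr (NeZero.pos N)).ne'] using swap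
  · intro a ha hab
    have ha' := hS a ha
    have h₁ : (b : ZMod N) ≠ a := fun h => hab (cast_inj (by omega) (by omega) h).symm
    have h₂ : (b : ZMod N) ≠ -a := ne_neg (by omega) (by omega)
    simp [b_ne_one, b_ne_neg_one, h₁, h₂]
  · exact fun h => absurd hb h

theorem DirichletCharacter.sum_mul_apply_mul {N : ℕ} [NeZero N] (χ : DirichletCharacter ℂ N)
    (f : ZMod N → ℂ) {a : ZMod N} (ha : IsUnit a) :
    ∑ c, χ c * f (a * c) = χ⁻¹ a * ∑ c, χ c * f c := by
  obtain ⟨u, rfl⟩ := ha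
  rw [← Equiv.sum_comp (Units.mulLeft u) (fun c => χ c * f c), Finset.mul_sum]
  refine Finset.sum_congr rfl fun c _ => ?_
  have : χ⁻¹ u * χ u = 1 := by
    rw [← MulChar.mul_apply, inv_mul_cancel, MulChar.one_apply u.isUnit]
  rw [Units.mulLeft_apply, map_mul]
  linear_combination -(χ c * f (u * c)) * this

/-- The real logarithms of the conjugates of a multiplicative relation. -/
theorem log_norm_relation {N : ℕ} [NeZero N] (hN : 1 < N) {α : ℤ} {S : Finset ℕ} {β : ℕ → ℤ}
    (hS : ∀ a ∈ S, a.Coprime N) {c : ZMod N} (hc : IsUnit c)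
    (h : (1 - ZMod.stdAddChar c) ^ α *
      ∏ a ∈ S, ((1 - ZMod.stdAddChar c ^ a) / (1 - ZMod.stdAddChar c)) ^ β a = 1) :
    α * Real.log ‖1 - ZMod.stdAddChar c‖ + ∑ a ∈ S, β a *
      (Real.log ‖1 - ZMod.stdAddChar ((a : ZMod N) * c)‖ - Real.log ‖1 - ZMod.stdAddChar c‖) = 0 := by
  have : Fact (1 < N) := ⟨hN⟩
  have ne {d : ZMod N} (hd : IsUnit d) : ‖1 - ZMod.stdAddChar d‖ ≠ 0 :=
    norm_ne_zero_iff.mpr (sub_ne_zero.mpr (ZMod.stdAddChar_ne_one hd.ne_zero).symm)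
  simp_rw [← ZMod.stdAddChar_natCast_mul] at h
  have ne' {a : ℕ} (ha : a ∈ S) : ‖1 - ZMod.stdAddChar ((a : ZMod N) * c)‖ ≠ 0 :=
    ne (((ZMod.isUnit_iff_coprime a N).mpr (hS a ha)).mul hc)
  replace h := congrArg (fun z : ℂ => Real.log ‖z‖) h
  simp only [norm_mul, norm_prod, norm_zpow, norm_div, norm_one, Real.log_one] at h
  rw [Real.log_mul (zpow_ne_zero _ (ne hc)) (Finset.prod_ne_zero_iff.mpr fun a ha =>
    zpow_ne_zero _ (div_ne_zero (ne' ha) (ne hc))), Real.log_zpow, Real.log_prod fun a ha =>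
    zpow_ne_zero _ (div_ne_zero (ne' ha) (ne hc))] at h
  rw [← h]
  congr 1
  refine Finset.sum_congr rfl fun a ha => ?_
  rw [Real.log_zpow, Real.log_div (ne' ha) (ne hc)]

/-- Let `p` be prime, `q = p^m` with `m ≥ 1`, and `ζ_q = exp(2πi/q)`.  The numbers
`1 - ζ_q` together with the numbers `(1 - ζ_q^a)/(1 - ζ_q)`, for `1 < a < q/2` with
`gcd(a, q) = 1`, are multiplicatively independent. -/
theorem mult_indep_single_prime_power_cyclotomic_units (p m : ℕ)
    (hp : p.Prime) (hm : 0 < m) (q : ℕ) (hq : q = p ^ m)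
    (ζ : ℂ) (hζ : ζ = Complex.exp (2 * Real.pi * Complex.I / (q : ℂ)))
    (α : ℤ) (β : ℕ → ℤ)
    (hprod : (1 - ζ) ^ α *
        ∏ a ∈ (Finset.range q).filter
            (fun a => 1 < a ∧ 2 * a < q ∧ Nat.gcd a q = 1),
          ((1 - ζ ^ a) / (1 - ζ)) ^ β a = 1) :
    α = 0 ∧ (∀ a, 1 < a → 2 * a < q → Nat.gcd a q = 1 → β a = 0) := by
  have hq1 : 1 < q := hq ▸ Nat.one_lt_pow hm.ne' hp.one_lt
  have : NeZero q := ⟨by omega⟩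
  set S := (Finset.range q).filter (fun a => 1 < a ∧ 2 * a < q ∧ Nat.gcd a q = 1)
  have hS (a : ℕ) (ha : a ∈ S) : 1 < a ∧ 2 * a < q ∧ a.Coprime q := (Finset.mem_filter.mp ha).2
  set f : ZMod q → ℂ := fun j => (Real.log ‖1 - ZMod.stdAddChar j‖ : ℂ) with hf
  have relation {c : ZMod q} (hc : IsUnit c) :
      α * f c + ∑ a ∈ S, β a * (f (a * c) - f c) = 0 := by
    have h := log_norm_relation hq1 (fun a ha => (hS a ha).2.2) hc
      ((hζ ▸ Complex.isPrimitiveRoot_exp q (NeZero.ne q)).cyclotomic_relation_conj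
        (ZMod.isPrimitiveRoot_stdAddChar hc) hprod)
    simp only [hf]
    exact_mod_cast congrArg ofReal h
  have sum_inv (χ : DirichletCharacter ℂ q) (hχ : χ.Even) :
      (α : ℂ) + ∑ a ∈ S, (β a : ℂ) * (χ⁻¹ a - 1) = 0 := by
    have M_ne : ∑ j, χ j * f j ≠ 0 := by
      subst hq
      exact DirichletCharacter.sum_mul_log_norm_one_sub_ne_zero hp hm hχ
    refine (mul_eq_zero.mp ?_).resolve_right M_ne
    calc ((α : ℂ) + ∑ a ∈ S, (β a : ℂ) * (χ⁻¹ a - 1)) * ∑ j, χ j * f j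
        = α * ∑ j, χ j * f j + ∑ a ∈ S, β a * (∑ j, χ j * f (a * j) - ∑ j, χ j * f j) := by
          rw [add_mul, Finset.sum_mul]
          congr 1
          refine Finset.sum_congr rfl fun a ha => ?_
          rw [χ.sum_mul_apply_mul f ((ZMod.isUnit_iff_coprime a q).mpr (hS a ha).2.2)]
          ring
      _ = ∑ j, χ j * (α * f j + ∑ a ∈ S, β a * (f (a * j) - f j)) := by
          simp_rw [← Finset.sum_sub_distrib, mul_add, Finset.mul_sum]
          rw [Finset.sum_add_distrib, Finset.sum_comm]
          congr 1
          · exact Finset.sum_congr rfl fun j _ => by ring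
          · exact Finset.sum_congr rfl fun j _ => Finset.sum_congr rfl fun a _ => by ring
      _ = 0 := Finset.sum_eq_zero fun j _ => by
          by_cases hj : IsUnit j
          · rw [relation hj, mul_zero]
          · rw [χ.map_nonunit hj, zero_mul]
  have sum_eq (χ : DirichletCharacter ℂ q) (hχ : χ.Even) :
      (α : ℂ) + ∑ a ∈ S, (β a : ℂ) * (χ a - 1) = 0 := by
    have h := sum_inv χ⁻¹ (by
      rw [DirichletCharacter.Even, MulChar.inv_apply_eq_inv, hχ, Ring.inverse_one])
    rwa [inv_inv] at h
  have hα : α = 0 := by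
    have h := sum_eq 1 (MulChar.one_apply isUnit_one.neg)
    rw [Finset.sum_eq_zero fun a ha => by
      rw [MulChar.one_apply ((ZMod.isUnit_iff_coprime a q).mpr (hS a ha).2.2), sub_self,
        mul_zero], add_zero] at h
    exact_mod_cast h
  refine ⟨hα, fun b h₁ h₂ h₃ => ?_⟩
  refine DirichletCharacter.coeff_eq_zero_of_even_sum_eq_zero hS (fun χ hχ => ?_)
    (Finset.mem_filter.mpr ⟨Finset.mem_range.mpr (by omega), h₁, h₂, h₃⟩)
  simpa [hα] using sum_eq χ hχ
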